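/- There exists a surjective K-algebra homomorphism π from R to the ring of Laurent polynomials K[t, t⁻¹] (LaurentPolynomial K) with π(X) = t⁻¹ and π(Y) = t, and the kernel of π, as a left ideal of R, equals J = Submodule.span R ({w} ∪ {ds * cs^j : j ∈ ℕ}). In particular R ⧸ J ≅ K[t, t⁻¹] as K-algebras. -/

import Mathlib

noncomputable section

/-- The defining relation `X * Y = 1` of the Jacobson algebra. -/
inductive JRel (K : Type*) [Field K] : FreeAlgebra K (Fin 2) → FreeAlgebra K (Fin 2) → Prop
  | rel : JRel K (FreeAlgebra.ι K 0 * FreeAlgebra.ι K 1) 1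

/-- The Jacobson algebra `K⟨X, Y | XY = 1⟩`. -/
abbrev Jacobson (K : Type*) [Field K] := RingQuot (JRel K)

variable (K : Type*) [Field K]

/-- The generator `X` of the Jacobson algebra. -/
def Xg : Jacobson K := RingQuot.mkAlgHom K (JRel K) (FreeAlgebra.ι K 0)

/-- The generator `Y` of the Jacobson algebra. -/
def Yg : Jacobson K := RingQuot.mkAlgHom K (JRel K) (FreeAlgebra.ι K 1)

/-- The loop `c = Y²X`. -/
def cJ : Jacobson K := Yg K ^ 2 * Xg K

/-- `F` is the set of irreducible polynomials `f ∈ K[x]` with `f(0) = -1`. -/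
def FSet : Set (Polynomial K) := {f | Irreducible f ∧ f.eval 0 = -1}

/-- The vertex idempotent `w = 1 - YX`. -/
def wJ : Jacobson K := 1 - Yg K * Xg K

/-- The ghost loop `c* = YX²`. -/
def csJ : Jacobson K := Yg K * Xg K ^ 2

/-- The ghost exit edge `d* = X - YX²`. -/
def dsJ : Jacobson K := Xg K - Yg K * Xg K ^ 2

/-- The socle of the Jacobson algebra, as a left ideal:
`J = span_R ({w} ∪ {ds * cs^j : j ∈ ℕ})`. -/
def socJ : Submodule (Jacobson K) (Jacobson K) :=
  Submodule.span (Jacobson K) ({wJ K} ∪ Set.range fun j : ℕ => dsJ K * csJ K ^ j)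

theorem XY : Xg K * Yg K = 1 := by
  have h := RingQuot.mkAlgHom_rel K (JRel.rel (K := K))
  simpa [Xg, Yg] using h

/-- The projection onto Laurent polynomials. -/
def piJ : Jacobson K →ₐ[K] LaurentPolynomial K :=
  RingQuot.liftAlgHom K ⟨FreeAlgebra.lift K
    (fun i : Fin 2 => if i = 0 then LaurentPolynomial.T (-1) else LaurentPolynomial.T 1), by
      intro x y h
      cases h
      rw [map_mul, map_one, FreeAlgebra.lift_ι_apply, FreeAlgebra.lift_ι_apply, if_pos rfl,
        if_neg (by decide), ← LaurentPolynomial.T_add]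
      exact LaurentPolynomial.T_zero⟩

theorem piJ_X : piJ K (Xg K) = LaurentPolynomial.T (-1) := by
  simp [piJ, Xg]

theorem piJ_Y : piJ K (Yg K) = LaurentPolynomial.T 1 := by
  simp [piJ, Yg]

/-- Lifts of the monomials. -/
def Zg (n : ℤ) : Jacobson K := Yg K ^ n.toNat * Xg K ^ (-n).toNat

theorem Zg_nat (n : ℕ) : Zg K n = Yg K ^ n := by simp [Zg]

theorem Zg_neg (n : ℕ) : Zg K (-n) = Xg K ^ n := by simp [Zg]

theorem piJ_Z (n : ℤ) : piJ K (Zg K n) = LaurentPolynomial.T n := by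
  rw [Zg, map_mul, map_pow, map_pow, piJ_X, piJ_Y, LaurentPolynomial.T_pow,
    LaurentPolynomial.T_pow, ← LaurentPolynomial.T_add]
  congr 1
  omega

/-- The linear section of the projection. -/
def secJ : LaurentPolynomial K →ₗ[K] Jacobson K :=
  (AddMonoidAlgebra.basis ℤ K).constr K (Zg K)

theorem secJ_T (n : ℤ) : secJ K (LaurentPolynomial.T n) = Zg K n :=
  (AddMonoidAlgebra.basis ℤ K).constr_basis K (Zg K) n

theorem C_mul_T_eq (a : K) (n : ℤ) :
    (LaurentPolynomial.C a * LaurentPolynomial.T n : LaurentPolynomial K)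
      = a • LaurentPolynomial.T n := by
  rw [LaurentPolynomial.smul_eq_C_mul]

theorem piJ_sec (p : LaurentPolynomial K) : piJ K (secJ K p) = p := by
  induction p using LaurentPolynomial.induction_on' with
  | add p q hp hq => rw [map_add, map_add, hp, hq]
  | C_mul_T n a => rw [C_mul_T_eq, map_smul, map_smul, secJ_T, piJ_Z]

theorem X_cs (j : ℕ) : Xg K * csJ K ^ j = Xg K ^ (j + 1) := by
  induction j with
  | zero => simp
  | succ j ih =>
    rw [pow_succ, ← mul_assoc, ih, csJ, pow_succ, mul_assoc, ← mul_assoc (Xg K) (Yg K), XY,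
      one_mul, ← pow_add]

theorem ds_eq : dsJ K = wJ K * Xg K := by
  rw [dsJ, wJ, sub_mul, one_mul, pow_two, mul_assoc]

theorem wX_mem (j : ℕ) : wJ K * Xg K ^ j ∈ socJ K := by
  apply Submodule.subset_span
  cases j with
  | zero => left; simp
  | succ j =>
    right
    exact ⟨j, by simp only [ds_eq, mul_assoc, X_cs]⟩

theorem soc_smul_sub (a : K) {x y : Jacobson K} (hx : x - y ∈ socJ K) :
    a • x - a • y ∈ socJ K := by
  rw [Algebra.smul_def, Algebra.smul_def, ← mul_sub]
  exact (socJ K).smul_mem _ hx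

theorem X_Z (n : ℤ) : Xg K * Zg K n = Zg K (-1 + n) := by
  rcases lt_or_ge 0 n with h | h
  · obtain ⟨m, rfl⟩ : ∃ m : ℕ, n = ((m + 1 : ℕ) : ℤ) := ⟨(n - 1).toNat, by omega⟩
    rw [show (-1 + ((m + 1 : ℕ) : ℤ)) = (m : ℤ) by push_cast; ring, Zg_nat, Zg_nat, pow_succ',
      ← mul_assoc, XY, one_mul]
  · obtain ⟨m, rfl⟩ : ∃ m : ℕ, n = -(m : ℤ) := ⟨(-n).toNat, by omega⟩
    rw [show (-1 + -(m : ℤ)) = -((m + 1 : ℕ) : ℤ) by push_cast; ring, Zg_neg, Zg_neg, pow_succ']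

theorem Y_Z (n : ℤ) : Yg K * Zg K n - Zg K (1 + n) ∈ socJ K := by
  rcases lt_or_ge n 0 with h | h
  · obtain ⟨m, rfl⟩ : ∃ m : ℕ, n = -((m + 1 : ℕ) : ℤ) := ⟨(-n - 1).toNat, by omega⟩
    rw [show (1 + -((m + 1 : ℕ) : ℤ)) = -(m : ℤ) by push_cast; ring, Zg_neg, Zg_neg]
    have h := (socJ K).neg_mem (wX_mem K m)
    rwa [wJ, sub_mul, one_mul, neg_sub, mul_assoc, ← pow_succ'] at h
  · obtain ⟨m, rfl⟩ : ∃ m : ℕ, n = (m : ℤ) := ⟨n.toNat, by omega⟩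
    rw [show (1 + (m : ℤ)) = ((m + 1 : ℕ) : ℤ) by push_cast; ring, Zg_nat, Zg_nat, pow_succ',
      sub_self]
    exact zero_mem _

theorem gen_sec (x : Jacobson K) (k : ℤ)
    (h : ∀ n, x * Zg K n - Zg K (k + n) ∈ socJ K) (p : LaurentPolynomial K) :
    x * secJ K p - secJ K (LaurentPolynomial.T k * p) ∈ socJ K := by
  induction p using LaurentPolynomial.induction_on' with
  | add p q hp hq =>
    have := add_mem hp hq
    rwa [sub_add_sub_comm, ← mul_add, ← map_add, ← map_add, ← mul_add] at this
  | C_mul_T n a =>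
    rw [C_mul_T_eq, mul_smul_comm, map_smul, map_smul, mul_smul_comm,
      ← LaurentPolynomial.T_add, secJ_T, secJ_T]
    exact soc_smul_sub K a (h n)

theorem gen_step (x a : Jacobson K) (k : ℤ)
    (h : ∀ n, x * Zg K n - Zg K (k + n) ∈ socJ K) (hx : piJ K x = LaurentPolynomial.T k)
    (ha : a - secJ K (piJ K a) ∈ socJ K) : x * a - secJ K (piJ K (x * a)) ∈ socJ K := by
  have h1 := add_mem ((socJ K).smul_mem x ha) (gen_sec K x k h (piJ K a))
  rwa [smul_eq_mul, mul_sub, sub_add_sub_cancel, ← hx, ← map_mul] at h1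

theorem sub_sec_mem_aux (f : FreeAlgebra K (Fin 2)) : ∀ a : Jacobson K,
    a - secJ K (piJ K a) ∈ socJ K →
      RingQuot.mkAlgHom K (JRel K) f * a
        - secJ K (piJ K (RingQuot.mkAlgHom K (JRel K) f * a)) ∈ socJ K := by
  induction f using FreeAlgebra.induction with
  | grade0 r =>
    intro a ha
    rw [AlgHom.commutes, ← Algebra.smul_def, map_smul, map_smul]
    exact soc_smul_sub K r ha
  | grade1 i =>
    intro a ha
    fin_cases i
    · exact gen_step K (Xg K) a (-1) (fun n => by rw [X_Z, sub_self]; exact zero_mem _)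
        (piJ_X K) ha
    · exact gen_step K (Yg K) a 1 (Y_Z K) (piJ_Y K) ha
  | mul f g hf hg =>
    intro a ha
    rw [map_mul, mul_assoc]
    exact hf _ (hg _ ha)
  | add f g hf hg =>
    intro a ha
    have := add_mem (hf a ha) (hg a ha)
    rwa [sub_add_sub_comm, ← map_add, ← map_add, ← add_mul, ← map_add] at this

theorem sub_sec_mem (a : Jacobson K) : a - secJ K (piJ K a) ∈ socJ K := by
  obtain ⟨f, rfl⟩ := RingQuot.mkAlgHom_surjective K (JRel K) a
  have h := sub_sec_mem_aux K f 1 (by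
    rw [map_one, ← LaurentPolynomial.T_zero, secJ_T]
    simp [Zg])
  rwa [mul_one] at h

theorem piJ_w : piJ K (wJ K) = 0 := by
  rw [wJ, map_sub, map_mul, piJ_X, piJ_Y, ← LaurentPolynomial.T_add]
  simp

/-- There is a surjective `K`-algebra map `π` from the Jacobson algebra onto the Laurent
polynomials with `π X = t⁻¹`, `π Y = t`, whose kernel, as a left ideal, is the socle `J`.
In particular `R ⧸ J ≅ K[t, t⁻¹]` as `K`-algebras. -/
theorem jacobson_mod_socle_iso_laurent :
    ∃ π : Jacobson K →ₐ[K] LaurentPolynomial K,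
      π (Xg K) = LaurentPolynomial.T (-1) ∧ π (Yg K) = LaurentPolynomial.T 1 ∧
        Function.Surjective π ∧ RingHom.ker π.toRingHom = socJ K := by
  refine ⟨piJ K, piJ_X K, piJ_Y K, fun p => ⟨secJ K p, piJ_sec K p⟩, ?_⟩
  apply le_antisymm
  · intro a ha
    have h0 : piJ K a = 0 := ha
    have h := sub_sec_mem K a
    rwa [h0, map_zero, sub_zero] at h
  · refine Submodule.span_le.2 ?_
    rintro x (rfl | ⟨j, rfl⟩)
    · exact piJ_w K
    · change piJ K (dsJ K * csJ K ^ j) = 0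
      rw [ds_eq, map_mul, map_mul, piJ_w, zero_mul, zero_mul]
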